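/- arXiv:2209.09283 — 2 statements merged into one kernel-verified Lean document; each statement's English description precedes it below -/
import Mathlib

section
/- For every triple (v₁, v₂, v₃) ∈ {0,1,2}³ there exists a squarefree integer d with 1 < d ≤ 609 such that the real quadratic field K_d = ℚ(√d) has class number h_d = 2 and (a_3, a_5, a_7) = (v₁, v₂, v₃), where a_n denotes the number of nonzero ideals of the ring of integers of K_d of absolute norm n. -/
open NumberField

/-- The number `a_n` of nonzero ideals of the ring of integers of `K` of absolute norm `n`. -/
noncomputable def aCoeff (K : Type*) [Field K] [NumberField K] (n : ℕ) : ℕ :=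
  Nat.card {I : Ideal (𝓞 K) // I ≠ ⊥ ∧ Ideal.absNorm I = n}

namespace QuadraticAlgebra

/-- Reduction modulo a root `r` of the polynomial `X² - b X - a` in `ZMod p`. -/
def evalRoot {a b : ℤ} {p : ℕ} (r : ZMod p) (hr : r * r = a + b * r) :
    QuadraticAlgebra ℤ a b →+* ZMod p :=
  (lift ⟨r, by simp [hr]⟩ : QuadraticAlgebra ℤ a b →ₐ[ℤ] ZMod p).toRingHom

theorem evalRoot_apply {a b : ℤ} {p : ℕ} (r : ZMod p) (hr : r * r = a + b * r)
    (z : QuadraticAlgebra ℤ a b) : evalRoot r hr z = z.re + z.im * r := by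
  simp [evalRoot, lift]

theorem algebra_norm_eq_norm {R : Type*} [CommRing R] {a b : R} (z : QuadraticAlgebra R a b) :
    Algebra.norm R z = z.norm := by
  rw [← det_toLinearMap_eq_norm, Algebra.norm_apply]
  rfl

theorem algebra_trace_eq_trace {R : Type*} [CommRing R] {a b : R} (z : QuadraticAlgebra R a b) :
    Algebra.trace R _ z = z.trace := by
  rw [Algebra.trace_eq_matrix_trace (basis a b), Matrix.trace_fin_two]
  simp [Algebra.leftMulMatrix_eq_repr_mul, trace_def, basis]
  ring

theorem discr_basis (a b : ℤ) : Algebra.discr ℤ (basis a b) = b ^ 2 + 4 * a := by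
  rw [Algebra.discr_def, Matrix.det_fin_two]
  simp [Algebra.traceMatrix_apply, Algebra.traceForm_apply, algebra_trace_eq_trace, trace_def,
    basis]
  ring

end QuadraticAlgebra

theorem Rat.exists_intCast_eq_of_squarefree {d : ℕ} (hd : Squarefree d) {w : ℚ} {n : ℤ}
    (h : d * w ^ 2 = n) : ∃ k : ℤ, w = k := by
  have hden : (w.den : ℚ) ≠ 0 := by exact_mod_cast w.den_ne_zero
  have hnum : (d : ℤ) * w.num ^ 2 = n * w.den ^ 2 := by
    have hw := Rat.num_div_den w
    rw [← hw] at h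
    field_simp at h
    rw [mul_comm n]
    exact_mod_cast h
  have hdvd : ((w.den * w.den : ℕ) : ℤ) ∣ d := by
    have hcop : IsCoprime ((w.den * w.den : ℕ) : ℤ) (w.num ^ 2) := by
      have : IsCoprime (w.den : ℤ) w.num :=
        (Int.isCoprime_iff_gcd_eq_one.mpr (by simpa [Int.gcd] using w.reduced)).symm
      push_cast
      exact (this.mul_left this).pow_right
    exact hcop.dvd_of_dvd_mul_right ⟨n, by rw [hnum]; push_cast; ring⟩
  have h1 : w.den = 1 := Nat.isUnit_iff.mp (hd _ (by exact_mod_cast hdvd))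
  exact ⟨w.num, (Rat.coe_int_num_of_den_eq_one h1).symm⟩

namespace NumberField

open scoped nonZeroDivisors

variable {K : Type*} [Field K] [NumberField K] {a b : ℤ}

theorem irrational_sq {d : ℕ} (hd : Squarefree d) (h1 : 1 < d) (r : ℚ) : r ^ 2 ≠ d := by
  intro h
  obtain ⟨k, rfl⟩ := Rat.exists_intCast_eq_of_squarefree (w := r) squarefree_one (n := d) (by simpa)
  have hk : k.natAbs * k.natAbs = d := by
    zify
    rw [← abs_mul, abs_mul_self]
    rw [pow_two] at h
    exact_mod_cast h
  have := Nat.isUnit_iff.mp (hd k.natAbs ⟨1, by rw [hk, mul_one]⟩)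
  rw [this] at hk
  omega

theorem exists_int_coords {d : ℕ} (hd : Squarefree d) (h1 : 1 < d) {α : K} (hα : α ^ 2 = d)
    (hK : Module.finrank ℚ K = 2) (z : 𝓞 K) :
    ∃ s w n : ℤ, s ^ 2 - d * w ^ 2 = 4 * n ∧ (2 : K) * z = s + w * α := by
  let f : QuadraticAlgebra ℚ (d : ℚ) 0 →ₐ[ℚ] K :=
    QuadraticAlgebra.lift ⟨α, by rw [← pow_two, hα]; simp [Algebra.smul_def]⟩
  have hf (u) : f u = u.re + u.im * α := by
    rw [show f u = u.re • 1 + u.im • α from rfl]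
    simp [Algebra.smul_def]
  have hbij : Function.Bijective f := by
    have hinj : Function.Injective f := by
      have : Fact (∀ r : ℚ, r ^ 2 ≠ d + 0 * r) :=
        ⟨fun r h ↦ irrational_sq hd h1 r (by simpa using h)⟩
      exact f.toRingHom.injective
    refine ⟨hinj, ?_⟩
    exact (LinearMap.injective_iff_surjective_of_finrank_eq_finrank (f := f.toLinearMap)
      (by rw [hK, QuadraticAlgebra.finrank_eq_two])).mp hinj
  let F := AlgEquiv.ofBijective f hbij
  obtain ⟨u, hu⟩ := hbij.2 (z : K)
  have hu' : F u = z := hu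
  have hz : IsIntegral ℤ (z : K) := z.2
  obtain ⟨s, hs⟩ := IsIntegrallyClosed.isIntegral_iff.mp (Algebra.isIntegral_trace (L := ℚ) hz)
  obtain ⟨n, hn⟩ := IsIntegrallyClosed.isIntegral_iff.mp (Algebra.isIntegral_norm ℚ hz)
  rw [← hu', Algebra.trace_eq_of_algEquiv F, QuadraticAlgebra.algebra_trace_eq_trace,
    QuadraticAlgebra.trace_def] at hs
  rw [← hu', Algebra.norm_eq_of_algEquiv F, QuadraticAlgebra.algebra_norm_eq_norm,
    QuadraticAlgebra.norm_def] at hn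
  simp only [eq_intCast] at hs hn
  have h4 : (d : ℚ) * (2 * u.im) ^ 2 = ((s ^ 2 - 4 * n : ℤ) : ℚ) := by
    push_cast
    rw [hs, hn]
    ring
  obtain ⟨w, hw⟩ := Rat.exists_intCast_eq_of_squarefree hd h4
  refine ⟨s, w, n, ?_, ?_⟩
  · rw [hw] at h4
    have : (d : ℤ) * w ^ 2 = s ^ 2 - 4 * n := by exact_mod_cast h4
    linarith
  · have hs' : (s : K) = 2 * (u.re : K) := by
      have : ((s : ℚ) : K) = ((2 * u.re : ℚ) : K) := by rw [hs]; simp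
      push_cast at this
      exact this
    have hw' : (w : K) = 2 * (u.im : K) := by
      have : ((w : ℚ) : K) = ((2 * u.im : ℚ) : K) := by rw [hw]
      push_cast at this
      exact this
    rw [← hu, hf, hs', hw']
    ring

/-- The integer `a` in the equation `ω² = a + b ω` of the standard generator `ω` of the ring of
integers of `ℚ(√d)`. -/
def quadA (d : ℕ) : ℤ := if d % 4 = 1 then (d - 1) / 4 else d

/-- The integer `b` in the equation `ω² = a + b ω` of the standard generator `ω` of the ring of
integers of `ℚ(√d)`. -/
def quadB (d : ℕ) : ℤ := if d % 4 = 1 then 1 else 0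

theorem exists_coords_of_half_coords {d : ℕ} (hd : Squarefree d) :
    ∃ c : ℤ, c ≠ 0 ∧ (d : ℤ) * (2 * c) ^ 2 = 4 * (quadB d ^ 2 + 4 * quadA d) ∧
      ∀ s w n : ℤ, s ^ 2 - d * w ^ 2 = 4 * n →
        ∃ x y : ℤ, 2 * x + quadB d * y = s ∧ c * y = w := by
  unfold quadA quadB
  have hmod : (d : ℤ) % 4 ≠ 0 := by
    intro h
    have : 2 * 2 ∣ d := by omega
    simpa using hd 2 this
  split_ifs with h
  · refine ⟨1, one_ne_zero, by omega, fun s w n hn ↦ ?_⟩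
    obtain ⟨k, hk⟩ : ∃ k, (d : ℤ) = 4 * k + 1 := ⟨d / 4, by omega⟩
    have hpar : (s - w) % 2 = 0 := by
      by_contra hne
      have : Odd (s - w) := Int.odd_iff.mpr (by omega)
      have h2 : Odd (s + w) := by
        have := this.add_even (even_two_mul w)
        rwa [show s - w + 2 * w = s + w by ring] at this
      have h3 := this.mul h2
      rw [show (s - w) * (s + w) = 2 * (2 * n + 2 * k * w ^ 2) by
        rw [hk] at hn; linear_combination hn] at h3
      exact (Int.not_odd_iff_even.mpr (even_two_mul _)) h3
    exact ⟨(s - w) / 2, w, by omega, by ring⟩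
  · refine ⟨2, two_ne_zero, by ring, fun s w n hn ↦ ?_⟩
    have hsw : s % 2 = 0 ∧ w % 2 = 0 := by
      have key : (s ^ 2 - d * w ^ 2) % 4 = 0 := by omega
      have hs : s % 4 = 0 ∨ s % 4 = 1 ∨ s % 4 = 2 ∨ s % 4 = 3 := by omega
      have hw : w % 4 = 0 ∨ w % 4 = 1 ∨ w % 4 = 2 ∨ w % 4 = 3 := by omega
      have hd' : (d : ℤ) % 4 = 2 ∨ (d : ℤ) % 4 = 3 := by omega
      rcases hs with hs | hs | hs | hs <;> rcases hw with hw | hw | hw | hw <;>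
        rcases hd' with hd' | hd' <;>
        simp [Int.sub_emod, Int.mul_emod, pow_two, hs, hw, hd'] at key <;> omega
    exact ⟨s / 2, w / 2, by omega, by omega⟩

theorem exists_quadraticAlgebra_equiv {d : ℕ} (hd : Squarefree d) (h1 : 1 < d) {α : K}
    (hα : α ^ 2 = d) (hK : Module.finrank ℚ K = 2) :
    Nonempty (QuadraticAlgebra ℤ (quadA d) (quadB d) ≃+* 𝓞 K) := by
  obtain ⟨c, hc, hd4, hspan⟩ := exists_coords_of_half_coords hd
  generalize quadA d = a, quadB d = b at *
  have hcK : (c : K) ≠ 0 := by exact_mod_cast hc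
  have hd4K : (d : K) * (2 * c) ^ 2 = 4 * (b ^ 2 + 4 * a) := by
    exact_mod_cast congrArg (Int.cast : ℤ → K) hd4
  let ω : K := (b + c * α) / 2
  have hω : ω * ω = a + b * ω := by
    simp only [ω]
    field_simp
    linear_combination (c : K) ^ 2 * hα + hd4K / 4
  have hint : IsIntegral ℤ ω := by
    refine ⟨.X ^ 2 - (.C b * .X + .C a), ?_, ?_⟩
    · exact Polynomial.monic_X_pow_sub (Polynomial.degree_linear_le.trans_lt (by norm_num))
    · simp only [Polynomial.eval₂_sub, Polynomial.eval₂_add, Polynomial.eval₂_mul,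
        Polynomial.eval₂_C, Polynomial.eval₂_X, pow_two, hω]
      simp [add_comm]
  obtain ⟨Ω, hΩω⟩ : ∃ Ω : 𝓞 K, algebraMap (𝓞 K) K Ω = ω := ⟨⟨ω, hint⟩, rfl⟩
  have hΩ : Ω * Ω = a • 1 + b • Ω := by
    apply FaithfulSMul.algebraMap_injective (𝓞 K) K
    rw [zsmul_one, zsmul_eq_mul, map_mul, map_add, map_mul, map_intCast, map_intCast, hΩω, hω]
  let f : QuadraticAlgebra ℤ a b →ₐ[ℤ] 𝓞 K := QuadraticAlgebra.lift ⟨Ω, hΩ⟩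
  have hf (u) : algebraMap (𝓞 K) K (f u) = u.re + u.im * ω := by
    rw [show f u = u.re • 1 + u.im • Ω from rfl, zsmul_one, zsmul_eq_mul,
      map_add, map_mul, map_intCast, map_intCast, hΩω]
  refine ⟨RingEquiv.ofBijective f ⟨?_, fun z ↦ ?_⟩⟩
  · rw [injective_iff_map_eq_zero]
    intro u hu
    have h0 : (u.re : K) + u.im * ω = 0 := by rw [← hf, hu]; simp
    have him : u.im = 0 := by
      by_contra him
      have himK : (u.im : K) ≠ 0 := by exact_mod_cast him
      refine irrational_sq hd h1 (-(2 * u.re + b * u.im) / (c * u.im)) ?_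
      have hαv : α = -(2 * u.re + b * u.im) / (c * u.im) := by
        simp only [ω] at h0
        field_simp at h0 ⊢
        linear_combination h0
      have : ((((-(2 * u.re + b * u.im) / (c * u.im) : ℚ)) ^ 2 : ℚ) : K) = ((d : ℚ) : K) := by
        push_cast
        rw [← hαv, hα]
      exact_mod_cast this
    have hre : u.re = 0 := by
      rw [him] at h0
      simpa using h0
    ext <;> simp [him, hre]
  · obtain ⟨s, w, n, hn, hz⟩ := exists_int_coords hd h1 hα hK z
    obtain ⟨x, y, hx, hy⟩ := hspan s w n hn
    refine ⟨⟨x, y⟩, ?_⟩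
    apply FaithfulSMul.algebraMap_injective (𝓞 K) K
    rw [hf]
    have h2 : (2 : K) ≠ 0 := two_ne_zero
    apply mul_left_cancel₀ h2
    rw [hz, ← hx, ← hy]
    simp only [ω]
    push_cast
    field_simp
    ring

theorem card_ideal_absNorm_eq_prime (e : QuadraticAlgebra ℤ a b ≃+* 𝓞 K) {p : ℕ}
    (hp : p.Prime) :
    Nat.card {I : Ideal (𝓞 K) // Ideal.absNorm I = p} =
      Nat.card {r : ZMod p // r * r = a + b * r} := by
  have : Fact p.Prime := ⟨hp⟩
  symm
  let ψ (r : {r : ZMod p // r * r = a + b * r}) : 𝓞 K →+* ZMod p :=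
    (QuadraticAlgebra.evalRoot r.1 r.2).comp e.symm.toRingHom
  have hψ (r) : Ideal.absNorm (RingHom.ker (ψ r)) = p := by
    rw [Ideal.absNorm_apply, Submodule.cardQuot_apply]
    change Nat.card (𝓞 K ⧸ RingHom.ker (ψ r)) = p
    rw [Nat.card_congr (RingHom.quotientKerEquivOfSurjective
      (ZMod.ringHom_surjective (ψ r))).toEquiv, Nat.card_zmod]
  refine Nat.card_congr (Equiv.ofBijective (fun r ↦ ⟨RingHom.ker (ψ r), hψ r⟩) ⟨?_, ?_⟩)
  · intro r s hrs
    have hker : RingHom.ker (ψ r) = RingHom.ker (ψ s) := congrArg Subtype.val hrs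
    obtain ⟨k, hk⟩ := ZMod.intCast_surjective r.1
    have hr : e ⟨-k, 1⟩ ∈ RingHom.ker (ψ r) := by
      simp [ψ, RingHom.mem_ker, QuadraticAlgebra.evalRoot_apply, hk]
    rw [hker] at hr
    simp only [ψ, RingHom.mem_ker, RingEquiv.toRingHom_eq_coe, RingHom.comp_apply,
      RingHom.coe_coe, RingEquiv.symm_apply_apply, QuadraticAlgebra.evalRoot_apply] at hr
    push_cast at hr
    rw [hk] at hr
    exact Subtype.ext (by linear_combination -hr)
  · rintro ⟨I, hI⟩
    have hcard : Nat.card (𝓞 K ⧸ I) = p := by rw [← hI]; rfl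
    have : Finite (𝓞 K ⧸ I) := Nat.finite_of_card_ne_zero (hcard ▸ hp.ne_zero)
    have : Fintype (𝓞 K ⧸ I) := Fintype.ofFinite _
    let φ := ZMod.ringEquivOfPrime (𝓞 K ⧸ I) hp (by rw [← Nat.card_eq_fintype_card, hcard])
    let χ : QuadraticAlgebra ℤ a b →+* ZMod p :=
      (φ.symm.toRingHom.comp (Ideal.Quotient.mk I)).comp e.toRingHom
    have hω : χ ⟨0, 1⟩ * χ ⟨0, 1⟩ = a + b * χ ⟨0, 1⟩ := by
      rw [← map_mul, ← map_intCast χ a, ← map_intCast χ b, ← map_mul, ← map_add]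
      congr 1
      ext <;> simp
    refine ⟨⟨χ ⟨0, 1⟩, hω⟩, Subtype.ext ?_⟩
    change RingHom.ker (ψ ⟨χ ⟨0, 1⟩, hω⟩) = I
    have heq : ψ ⟨χ ⟨0, 1⟩, hω⟩ = φ.symm.toRingHom.comp (Ideal.Quotient.mk I) := by
      ext x
      obtain ⟨z, rfl⟩ := e.surjective x
      have hz : z = (z.re : QuadraticAlgebra ℤ a b) + z.im * ⟨0, 1⟩ := by ext <;> simp
      have h1 : (φ.symm.toRingHom.comp (Ideal.Quotient.mk I)) (e z) = χ z := rfl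
      rw [h1]
      conv_rhs => rw [hz]
      rw [map_add, map_mul, map_intCast, map_intCast]
      simp [ψ, QuadraticAlgebra.evalRoot_apply]
    rw [heq]
    ext x
    simp [RingHom.mem_ker, Ideal.Quotient.eq_zero_iff_mem]

theorem aCoeff_prime (e : QuadraticAlgebra ℤ a b ≃+* 𝓞 K) {p : ℕ} (hp : p.Prime) :
    aCoeff K p = Nat.card {r : ZMod p // r * r = a + b * r} := by
  rw [← card_ideal_absNorm_eq_prime e hp]
  refine Nat.card_congr (Equiv.subtypeEquivRight fun I ↦ and_iff_right_of_imp ?_)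
  rintro h rfl
  exact hp.ne_zero (by rw [← h, Ideal.absNorm_bot])

omit [NumberField K] in
theorem algebra_norm_ringOfIntegers (e : QuadraticAlgebra ℤ a b ≃+* 𝓞 K)
    (z : QuadraticAlgebra ℤ a b) :
    Algebra.norm ℤ (e z) = z.re ^ 2 + b * z.re * z.im - a * z.im ^ 2 := by
  let e' : QuadraticAlgebra ℤ a b ≃ₐ[ℤ] 𝓞 K := AlgEquiv.ofRingEquiv (f := e) (by simp)
  have : Algebra.norm ℤ (e' z) = _ := Algebra.norm_eq_of_algEquiv e' z
  change Algebra.norm ℤ (e' z) = _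
  rw [this, QuadraticAlgebra.algebra_norm_eq_norm, QuadraticAlgebra.norm_def]
  ring

theorem discr_eq (e : QuadraticAlgebra ℤ a b ≃+* 𝓞 K) : discr K = b ^ 2 + 4 * a := by
  let e' : QuadraticAlgebra ℤ a b ≃ₐ[ℤ] 𝓞 K := AlgEquiv.ofRingEquiv (f := e) (by simp)
  rw [← discr_eq_discr K ((QuadraticAlgebra.basis a b).map e'.toLinearEquiv),
    ← QuadraticAlgebra.discr_basis, Algebra.discr_eq_discr_of_algEquiv _ e']
  rfl

theorem absNorm_span_natCast_of_finrank_eq_two (hK : Module.finrank ℚ K = 2) (p : ℕ) :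
    Ideal.absNorm (Ideal.span {(p : 𝓞 K)}) = p ^ 2 := by
  rw [Ideal.absNorm_span_natCast, RingOfIntegers.rank, hK]

theorem exists_dvd_of_prime_dvd_absNorm (hK : Module.finrank ℚ K = 2) {p : ℕ} (hp : p.Prime)
    {I : Ideal (𝓞 K)} (hI : p ∣ Ideal.absNorm I) :
    ∃ P, P ∣ I ∧ (Ideal.absNorm P = p ∨ P = Ideal.span {(p : 𝓞 K)}) := by
  obtain ⟨P, hmax, hunder, hPI⟩ := Ideal.exists_isMaximal_dvd_of_dvd_absNorm' hp I hI
  refine ⟨P, hPI, ?_⟩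
  have hpP : (p : 𝓞 K) ∈ P := by
    have : (p : ℤ) ∈ P.under ℤ := hunder ▸ Ideal.mem_span_singleton_self _
    simpa [Ideal.mem_comap] using this
  obtain ⟨R, hR⟩ := Ideal.dvd_span_singleton.mpr hpP
  have hn := absNorm_span_natCast_of_finrank_eq_two hK p
  obtain ⟨k, hk, hPk⟩ := (Nat.dvd_prime_pow hp).mp
    (hn ▸ Ideal.absNorm_dvd_absNorm_of_le (Ideal.le_of_dvd ⟨R, hR⟩) : Ideal.absNorm P ∣ p ^ 2)
  interval_cases k
  · exact absurd (Ideal.absNorm_eq_one_iff.mp (by simpa using hPk)) hmax.ne_top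
  · exact .inl (by simpa using hPk)
  · right
    rw [hR, map_mul, hPk] at hn
    have : Ideal.absNorm R = 1 := Nat.eq_of_mul_eq_mul_left (pow_pos hp.pos 2) (by simpa using hn)
    rw [hR, Ideal.absNorm_eq_one_iff.mp this, Ideal.mul_top]

theorem eq_or_mul_eq_span_of_absNorm_eq_prime (hK : Module.finrank ℚ K = 2) {p : ℕ}
    (hp : p.Prime) {P Q : Ideal (𝓞 K)} (hP : Ideal.absNorm P = p) (hQ : Ideal.absNorm Q = p) :
    P = Q ∨ P * Q = Ideal.span {(p : 𝓞 K)} := by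
  have eq_of_dvd {I J : Ideal (𝓞 K)} (hI : Ideal.absNorm I = p) (hJ : Ideal.absNorm J = p)
      (h : I ∣ J) : I = J := by
    obtain ⟨L, rfl⟩ := h
    rw [map_mul, hI] at hJ
    have : Ideal.absNorm L = 1 := Nat.eq_of_mul_eq_mul_left hp.pos (by simpa using hJ)
    rw [Ideal.absNorm_eq_one_iff.mp this, Ideal.mul_top]
  have hn := absNorm_span_natCast_of_finrank_eq_two hK p
  have hP0 : P ≠ ⊥ := by rintro rfl; exact hp.ne_zero (by rw [← hP, Ideal.absNorm_bot])
  have hprime : Prime P := Ideal.prime_of_isPrime hP0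
    (Ideal.isPrime_of_irreducible_absNorm (hP ▸ hp))
  obtain ⟨R, hR⟩ := Ideal.dvd_span_singleton.mpr (hQ ▸ Ideal.absNorm_mem Q : (p : 𝓞 K) ∈ Q)
  have hRn : Ideal.absNorm R = p := by
    rw [hR, map_mul, hQ, pow_two] at hn
    exact Nat.eq_of_mul_eq_mul_left hp.pos hn
  have hPR : P ∣ Q * R :=
    hR ▸ Ideal.dvd_span_singleton.mpr (hP ▸ Ideal.absNorm_mem P : (p : 𝓞 K) ∈ P)
  rcases hprime.dvd_or_dvd hPR with h | h
  · exact .inl (eq_of_dvd hP hQ h)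
  · right
    rw [hR, eq_of_dvd hP hRn h, mul_comm]

/-- Every ideal of norm `n` has its class in `H`. -/
def ClassesOfNormIn (H : Subgroup (ClassGroup (𝓞 K))) (n : ℕ) : Prop :=
  ∀ I : (Ideal (𝓞 K))⁰, Ideal.absNorm (I : Ideal (𝓞 K)) = n → ClassGroup.mk0 I ∈ H

theorem mk0_eq_one_of_eq_span {I : (Ideal (𝓞 K))⁰} {x : 𝓞 K}
    (h : (I : Ideal (𝓞 K)) = Ideal.span {x}) : ClassGroup.mk0 I = 1 :=
  (ClassGroup.mk0_eq_one_iff I.2).mpr (h ▸ ⟨x, rfl⟩)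

omit [NumberField K] in
theorem exists_mul_eq_of_dvd {I : (Ideal (𝓞 K))⁰} {P : Ideal (𝓞 K)}
    (h : P ∣ (I : Ideal (𝓞 K))) :
    ∃ P' J : (Ideal (𝓞 K))⁰, (P' : Ideal (𝓞 K)) = P ∧ I = P' * J := by
  obtain ⟨J, hJ⟩ := h
  have h0 := nonZeroDivisors.coe_ne_zero I
  rw [hJ] at h0
  exact ⟨⟨P, mem_nonZeroDivisors_of_ne_zero (left_ne_zero_of_mul h0)⟩,
    ⟨J, mem_nonZeroDivisors_of_ne_zero (right_ne_zero_of_mul h0)⟩, rfl, Subtype.ext hJ⟩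

namespace ClassesOfNormIn

variable {H : Subgroup (ClassGroup (𝓞 K))}

theorem of_forall_prime (hK : Module.finrank ℚ K = 2) (n : ℕ)
    (h : ∀ p, p.Prime → p ∣ n → ClassesOfNormIn H p) : ClassesOfNormIn H n := by
  induction n using Nat.strong_induction_on with | _ n ih =>
  intro I hI
  have hn0 : n ≠ 0 := hI ▸ Ideal.absNorm_ne_zero_of_nonZeroDivisors I
  by_cases hn : n = 1
  · have : (I : Ideal (𝓞 K)) = Ideal.span {1} := by
      rw [Ideal.span_singleton_one]
      exact Ideal.absNorm_eq_one_iff.mp (hI.trans hn)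
    rw [mk0_eq_one_of_eq_span this]
    exact one_mem H
  obtain ⟨p, hp, hpn⟩ := Nat.exists_prime_and_dvd hn
  obtain ⟨P, hPI, hP⟩ := exists_dvd_of_prime_dvd_absNorm hK hp (hI ▸ hpn)
  obtain ⟨P, J, rfl, rfl⟩ := exists_mul_eq_of_dvd hPI
  rw [Submonoid.coe_mul, map_mul] at hI
  have hPn : Ideal.absNorm (P : Ideal (𝓞 K)) ≠ 1 := by
    rcases hP with hP | hP
    · rw [hP]; exact hp.ne_one
    · rw [hP, absNorm_span_natCast_of_finrank_eq_two hK]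
      exact (Nat.one_lt_pow two_ne_zero hp.one_lt).ne'
  have hP0 := Ideal.absNorm_ne_zero_of_nonZeroDivisors P
  have hJ0 := Ideal.absNorm_pos_of_nonZeroDivisors J
  rw [map_mul]
  refine mul_mem ?_ (ih _ ?_ (fun q hq hqJ ↦ h q hq (hI ▸ hqJ.mul_left _)) J rfl)
  · rcases hP with hP | hP
    · exact h p hp hpn P hP
    · rw [mk0_eq_one_of_eq_span hP]
      exact one_mem H
  · rw [← hI]
    exact lt_mul_of_one_lt_left hJ0 (by omega)

theorem of_norm_eq_mul (hK : Module.finrank ℚ K = 2) {p m : ℕ} (hp : p.Prime) {x : 𝓞 K}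
    (hx0 : x ≠ 0) (hx : (Algebra.norm ℤ x).natAbs = p * m)
    (hm : ∀ q, q.Prime → q ∣ m → ClassesOfNormIn H q) : ClassesOfNormIn H p := by
  by_cases hpm : p ∣ m
  · exact hm p hp hpm
  intro P hP
  let I : (Ideal (𝓞 K))⁰ := ⟨Ideal.span {x}, mem_nonZeroDivisors_of_ne_zero (by simpa using hx0)⟩
  have hI : Ideal.absNorm (I : Ideal (𝓞 K)) = p * m := by rw [← hx, Ideal.absNorm_span_singleton]
  obtain ⟨Q, hQI, hQ⟩ := exists_dvd_of_prime_dvd_absNorm hK hp (hI ▸ dvd_mul_right p m)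
  obtain ⟨Q, J, rfl, hQJ⟩ := exists_mul_eq_of_dvd hQI
  have hn := hI
  rw [hQJ, Submonoid.coe_mul, map_mul] at hn
  have hQ : Ideal.absNorm (Q : Ideal (𝓞 K)) = p := by
    refine hQ.resolve_right fun hQ ↦ hpm ?_
    rw [hQ, absNorm_span_natCast_of_finrank_eq_two hK, pow_two, mul_assoc] at hn
    exact ⟨_, (Nat.eq_of_mul_eq_mul_left hp.pos hn).symm⟩
  have hJ : ClassGroup.mk0 J ∈ H := of_forall_prime hK m hm J
    (Nat.eq_of_mul_eq_mul_left hp.pos (hQ ▸ hn))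
  have hQH : ClassGroup.mk0 Q ∈ H := by
    have : ClassGroup.mk0 Q * ClassGroup.mk0 J = 1 := by
      rw [← map_mul, ← hQJ]
      exact mk0_eq_one_of_eq_span rfl
    rw [eq_inv_of_mul_eq_one_left this]
    exact inv_mem hJ
  rcases eq_or_mul_eq_span_of_absNorm_eq_prime hK hp hP hQ with h | h
  · rwa [Subtype.ext h]
  · have : ClassGroup.mk0 P * ClassGroup.mk0 Q = 1 := by
      rw [← map_mul]
      exact mk0_eq_one_of_eq_span h
    rw [eq_inv_of_mul_eq_one_left this]
    exact inv_mem hQH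

theorem zpowers (hK : Module.finrank ℚ K = 2) {Q : (Ideal (𝓞 K))⁰} {q : ℕ} (hq : q.Prime)
    (hQ : Ideal.absNorm (Q : Ideal (𝓞 K)) = q) :
    ClassesOfNormIn (Subgroup.zpowers (ClassGroup.mk0 Q)) q := by
  intro P hP
  rcases eq_or_mul_eq_span_of_absNorm_eq_prime hK hq hP hQ with h | h
  · rw [Subtype.ext h]
    exact Subgroup.mem_zpowers _
  · have : ClassGroup.mk0 P * ClassGroup.mk0 Q = 1 := by
      rw [← map_mul]
      exact mk0_eq_one_of_eq_span h
    rw [eq_inv_of_mul_eq_one_left this]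
    exact inv_mem (Subgroup.mem_zpowers _)

end ClassesOfNormIn

theorem exists_absNorm_eq_and_sq_eq_one (hK : Module.finrank ℚ K = 2) {q : ℕ} (hq : q.Prime)
    {x : 𝓞 K} (hx : (Algebra.norm ℤ x).natAbs = q ^ 2) (hqx : ¬ (q : 𝓞 K) ∣ x) :
    ∃ Q : (Ideal (𝓞 K))⁰, Ideal.absNorm (Q : Ideal (𝓞 K)) = q ∧ ClassGroup.mk0 Q ^ 2 = 1 := by
  have hx0 : x ≠ 0 := by
    rintro rfl
    exact hqx (dvd_zero _)
  let I : (Ideal (𝓞 K))⁰ := ⟨Ideal.span {x}, mem_nonZeroDivisors_of_ne_zero (by simpa using hx0)⟩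
  have hI : Ideal.absNorm (I : Ideal (𝓞 K)) = q * q := by
    rw [← pow_two, ← hx, Ideal.absNorm_span_singleton]
  obtain ⟨Q, hQI, hQ⟩ := exists_dvd_of_prime_dvd_absNorm hK hq (hI ▸ dvd_mul_right q q)
  have hQ : Ideal.absNorm Q = q := by
    refine hQ.resolve_right fun hQ ↦ hqx ?_
    rw [hQ] at hQI
    exact Ideal.mem_span_singleton.mp (Ideal.dvd_span_singleton.mp hQI)
  obtain ⟨Q, R, rfl, hQR⟩ := exists_mul_eq_of_dvd hQI
  have hR : Ideal.absNorm (R : Ideal (𝓞 K)) = q := by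
    rw [hQR, Submonoid.coe_mul, map_mul, hQ] at hI
    exact Nat.eq_of_mul_eq_mul_left hq.pos hI
  refine ⟨Q, hQ, ?_⟩
  rcases eq_or_mul_eq_span_of_absNorm_eq_prime hK hq hQ hR with h | h
  · rw [pow_two, ← map_mul]
    nth_rewrite 2 [Subtype.ext h]
    rw [← hQR]
    exact mk0_eq_one_of_eq_span rfl
  · refine absurd ?_ hqx
    rw [← Submonoid.coe_mul, ← hQR] at h
    exact Ideal.mem_span_singleton.mp (h ▸ Ideal.mem_span_singleton_self x)

theorem exists_mk0_eq_of_discr_lt (hK : Module.finrank ℚ K = 2) (h0 : 0 < discr K) {M : ℕ}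
    (hM : discr K < 4 * (M + 1) ^ 2) (C : ClassGroup (𝓞 K)) :
    ∃ I : (Ideal (𝓞 K))⁰, ClassGroup.mk0 I = C ∧ Ideal.absNorm (I : Ideal (𝓞 K)) ≤ M := by
  obtain ⟨I, hIC, hI⟩ := exists_ideal_in_class_of_norm_le C
  refine ⟨I, hIC, ?_⟩
  have hr : InfinitePlace.nrComplexPlaces K = 0 := by
    have h1 := InfinitePlace.card_add_two_mul_card_eq_rank K
    have h2 := sign_discr K
    rw [Int.sign_eq_one_of_pos h0] at h2
    have h3 : InfinitePlace.nrComplexPlaces K ≠ 1 := by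
      intro h
      rw [h] at h2
      norm_num at h2
    omega
  have hlt : √|(discr K : ℝ)| < 2 * (M + 1) := by
    rw [Real.sqrt_lt' (by positivity), abs_of_pos (by exact_mod_cast h0)]
    have : (discr K : ℝ) < 4 * (M + 1) ^ 2 := by exact_mod_cast hM
    linarith
  rw [hr, hK] at hI
  norm_num [Nat.factorial] at hI
  have : (Ideal.absNorm (I : Ideal (𝓞 K)) : ℝ) < (M + 1 : ℕ) := by
    push_cast
    linarith
  exact Nat.lt_succ_iff.mp (by exact_mod_cast this)

theorem classNumber_eq_two (hK : Module.finrank ℚ K = 2) (h0 : 0 < discr K) {M q : ℕ}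
    (hM : discr K < 4 * (M + 1) ^ 2) (hq : q.Prime) {x : 𝓞 K}
    (hx : (Algebra.norm ℤ x).natAbs = q ^ 2) (hqx : ¬ (q : 𝓞 K) ∣ x)
    (hne : ∀ y : 𝓞 K, (Algebra.norm ℤ y).natAbs ≠ q)
    (hgen : ∀ H : Subgroup (ClassGroup (𝓞 K)), ClassesOfNormIn H q →
      ∀ p, p.Prime → p ≤ M → ClassesOfNormIn H p) : classNumber K = 2 := by
  obtain ⟨Q, hQ, hsq⟩ := exists_absNorm_eq_and_sq_eq_one hK hq hx hqx
  have hQ1 : ClassGroup.mk0 Q ≠ 1 := by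
    intro h
    obtain ⟨y, hy⟩ := (ClassGroup.mk0_eq_one_iff Q.2).mp h
    apply hne y
    rw [← Ideal.absNorm_span_singleton, ← hQ]
    exact congrArg _ hy.symm
  have htop : Subgroup.zpowers (ClassGroup.mk0 Q) = ⊤ := by
    rw [Subgroup.eq_top_iff']
    intro C
    obtain ⟨I, rfl, hI⟩ := exists_mk0_eq_of_discr_lt hK h0 hM C
    refine ClassesOfNormIn.of_forall_prime hK _ (fun p hp hpI ↦ hgen _ (.zpowers hK hq hQ) p hp ?_)
      I rfl
    exact (Nat.le_of_dvd (Ideal.absNorm_pos_of_nonZeroDivisors I) hpI).trans hI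
  rw [classNumber, ← Nat.card_eq_fintype_card, ← Subgroup.card_top, ← htop, Nat.card_zpowers]
  exact orderOf_eq_prime hsq hQ1

/-- Given primes `S` whose ideals have already been dealt with, the list entries `(p, x, y, l)`
record elements `x + y ω` of norm `± p * l.prod`, where `l` consists of primes dealt with before
`p`. -/
def IsNormChain (a b : ℤ) : List ℕ → List (ℕ × ℤ × ℤ × List ℕ) → Prop
  | _, [] => True
  | S, (p, x, y, l) :: c =>
    (p.Prime ∧ (x ^ 2 + b * x * y - a * y ^ 2).natAbs = p * l.prod ∧ ∀ q ∈ l, q ∈ S) ∧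
      IsNormChain a b (p :: S) c

instance IsNormChain.decidable (a b : ℤ) :
    ∀ (S : List ℕ) (c : List (ℕ × ℤ × ℤ × List ℕ)), Decidable (IsNormChain a b S c)
  | _, [] => .isTrue trivial
  | S, (p, x, y, l) :: c =>
    have := IsNormChain.decidable a b (p :: S) c
    inferInstanceAs (Decidable ((p.Prime ∧ (x ^ 2 + b * x * y - a * y ^ 2).natAbs = p * l.prod ∧
      ∀ q ∈ l, q ∈ S) ∧ IsNormChain a b (p :: S) c))

theorem ClassesOfNormIn.of_isNormChain (e : QuadraticAlgebra ℤ a b ≃+* 𝓞 K)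
    (hK : Module.finrank ℚ K = 2) {H : Subgroup (ClassGroup (𝓞 K))}
    {c : List (ℕ × ℤ × ℤ × List ℕ)} {S : List ℕ} (hc : IsNormChain a b S c)
    (hS : ∀ p ∈ S, p.Prime ∧ ClassesOfNormIn H p) : ∀ p ∈ c.map Prod.fst, ClassesOfNormIn H p := by
  induction c generalizing S with
  | nil => simp
  | cons t c ih =>
    obtain ⟨p, x, y, l⟩ := t
    obtain ⟨⟨hp, hnorm, hl⟩, hc⟩ := hc
    have hpH : ClassesOfNormIn H p := by
      refine of_norm_eq_mul hK hp (x := e ⟨x, y⟩) (m := l.prod) ?_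
        (by rw [algebra_norm_ringOfIntegers]; exact hnorm) fun q hq hql ↦ ?_
      · intro h0
        have h := algebra_norm_ringOfIntegers e ⟨x, y⟩
        rw [h0, Algebra.norm_zero] at h
        dsimp only at h
        rw [← h, Int.natAbs_zero, eq_comm, mul_eq_zero, or_iff_right hp.ne_zero,
          List.prod_eq_zero_iff] at hnorm
        exact (hS 0 (hl 0 hnorm)).1.ne_zero rfl
      · obtain ⟨r, hr, hqr⟩ := (Prime.dvd_prod_iff hq.prime).mp hql
        obtain ⟨hrp, hrH⟩ := hS r (hl r hr)
        rwa [(Nat.prime_dvd_prime_iff_eq hq hrp).mp hqr]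
    simp only [List.map_cons, List.forall_mem_cons]
    exact ⟨hpH, ih hc (List.forall_mem_cons.mpr ⟨⟨hp, hpH⟩, hS⟩)⟩

theorem ClassesOfNormIn.of_no_root (e : QuadraticAlgebra ℤ a b ≃+* 𝓞 K)
    {H : Subgroup (ClassGroup (𝓞 K))} {p : ℕ} (hp : p.Prime)
    (h : ∀ r < p, ¬ (p : ℤ) ∣ (r * r - (a + b * r) : ℤ)) : ClassesOfNormIn H p := by
  intro I hI
  have : Fact p.Prime := ⟨hp⟩
  have hempty : IsEmpty {r : ZMod p // r * r = a + b * r} := by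
    refine ⟨fun ⟨r, hr⟩ ↦ h r.val r.val_lt ?_⟩
    rw [← ZMod.intCast_zmod_eq_zero_iff_dvd]
    simp [hr]
  have hcard := card_ideal_absNorm_eq_prime e hp
  rw [@Nat.card_of_isEmpty _ hempty] at hcard
  have : Finite {I : Ideal (𝓞 K) // Ideal.absNorm I = p} :=
    (Ideal.finite_setOfPred_absNorm_eq p).to_subtype
  exact ((Finite.card_eq_zero_iff.mp hcard).false ⟨I, hI⟩).elim

/-- Data from which the class number of the real quadratic field `ℚ(√d)` is seen to be two:
`M` bounds the norms needed to represent all ideal classes, `x + y ω` generates the square of an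
ideal of prime norm `q`, which is not principal by a congruence obstruction modulo `m`; the primes
up to `M` other than `q` are in `inert` or reached by `chain`. -/
structure ClassNumberTwoCert where
  /-- The radicand. -/
  d : ℕ
  /-- The norm bound for representatives of the ideal classes. -/
  M : ℕ
  /-- The norm of a nonprincipal prime ideal. -/
  q : ℕ
  /-- The modulus of the congruence obstruction. -/
  m : ℕ
  /-- The rational coordinate of an element of norm `± q ^ 2`. -/
  x : ℤ
  /-- The coordinate at `ω` of an element of norm `± q ^ 2`. -/
  y : ℤ
  /-- Primes which are not the norm of an ideal. -/
  inert : List ℕ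
  /-- The relations for the remaining primes. -/
  chain : List (ℕ × ℤ × ℤ × List ℕ)

namespace ClassNumberTwoCert

/-- The conditions under which the data proves that the class number of `ℚ(√d)` is two. -/
def Valid (c : ClassNumberTwoCert) : Prop :=
  (0 < quadB c.d ^ 2 + 4 * quadA c.d ∧
    quadB c.d ^ 2 + 4 * quadA c.d < 4 * ((c.M : ℤ) + 1) ^ 2) ∧
  (c.q.Prime ∧ 0 < c.m ∧
    (c.x ^ 2 + quadB c.d * c.x * c.y - quadA c.d * c.y ^ 2).natAbs = c.q ^ 2 ∧
    ¬ ((c.q : ℤ) ∣ c.x ∧ (c.q : ℤ) ∣ c.y)) ∧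
  (∀ u < c.m, ∀ v < c.m,
    ¬ (c.m : ℤ) ∣ (u ^ 2 + quadB c.d * u * v - quadA c.d * v ^ 2 - c.q : ℤ) ∧
    ¬ (c.m : ℤ) ∣ (u ^ 2 + quadB c.d * u * v - quadA c.d * v ^ 2 + c.q : ℤ)) ∧
  (∀ p ∈ c.inert, p.Prime ∧ ∀ r < p, ¬ (p : ℤ) ∣ (r * r - (quadA c.d + quadB c.d * r) : ℤ)) ∧
  IsNormChain (quadA c.d) (quadB c.d) (c.q :: c.inert) c.chain ∧
  ∀ p ≤ c.M, p.Prime → p = c.q ∨ p ∈ c.inert ∨ p ∈ c.chain.map Prod.fst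

instance (c : ClassNumberTwoCert) : Decidable c.Valid := by
  unfold Valid
  infer_instance

theorem Valid.classNumber_eq_two {c : ClassNumberTwoCert} (hc : c.Valid)
    (hK : Module.finrank ℚ K = 2)
    (e : QuadraticAlgebra ℤ (quadA c.d) (quadB c.d) ≃+* 𝓞 K) : classNumber K = 2 := by
  obtain ⟨⟨h0, hM⟩, ⟨hq, hm, hnorm, hdvd⟩, hobs, hinert, hchain, hcover⟩ := hc
  rw [← discr_eq e] at h0 hM
  refine NumberField.classNumber_eq_two hK h0 hM hq (x := e ⟨c.x, c.y⟩)
    (by rw [algebra_norm_ringOfIntegers]; exact hnorm) ?_ ?_ ?_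
  · rintro ⟨w, hw⟩
    obtain ⟨z, rfl⟩ := e.surjective w
    rw [← map_natCast e, ← map_mul] at hw
    have hz := e.injective hw
    exact hdvd ⟨⟨z.re, by simpa using congrArg QuadraticAlgebra.re hz⟩,
      ⟨z.im, by simpa using congrArg QuadraticAlgebra.im hz⟩⟩
  · intro w hw
    obtain ⟨z, rfl⟩ := e.surjective w
    rw [algebra_norm_ringOfIntegers] at hw
    have : NeZero c.m := ⟨hm.ne'⟩
    obtain ⟨h1, h2⟩ := hobs _ (ZMod.val_lt (z.re : ZMod c.m)) _ (ZMod.val_lt (z.im : ZMod c.m))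
    rw [← ZMod.intCast_zmod_eq_zero_iff_dvd] at h1 h2
    rcases Int.natAbs_eq_iff.mp hw with h | h
    · apply h1
      have := congrArg (Int.cast : ℤ → ZMod c.m) h
      push_cast at this
      simp [this]
    · apply h2
      have := congrArg (Int.cast : ℤ → ZMod c.m) h
      push_cast at this
      simp [this]
  · intro H hH p hp hpM
    have hin : ∀ p ∈ c.inert, p.Prime ∧ ClassesOfNormIn H p := fun p hp ↦
      ⟨(hinert p hp).1, .of_no_root e (hinert p hp).1 (hinert p hp).2⟩
    rcases hcover p hpM hp with rfl | h | h
    · exact hH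
    · exact (hin p h).2
    · exact ClassesOfNormIn.of_isNormChain e hK hchain
        (List.forall_mem_cons.mpr ⟨⟨hq, hH⟩, hin⟩) p h

end ClassNumberTwoCert

/-- The number of roots modulo `p` of the minimal polynomial of the standard generator of the ring
of integers of `ℚ(√d)`. -/
def rootCount (d p : ℕ) [NeZero p] : ℕ :=
  Fintype.card {r : ZMod p // r * r = quadA d + quadB d * r}

theorem ClassNumberTwoCert.exists_field {v₁ v₂ v₃ : ℕ} (c : ClassNumberTwoCert)
    (h : (1 < c.d ∧ c.d ≤ 609) ∧ Squarefree c.d ∧ c.Valid ∧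
      rootCount c.d 3 = v₁ ∧ rootCount c.d 5 = v₂ ∧ rootCount c.d 7 = v₃) :
    ∃ d : ℕ, 1 < d ∧ d ≤ 609 ∧ Squarefree d ∧
      ∀ (K : Type) [Field K] [NumberField K] (α : K),
        α ^ 2 = (d : K) → Module.finrank ℚ K = 2 →
          classNumber K = 2 ∧ aCoeff K 3 = v₁ ∧ aCoeff K 5 = v₂ ∧ aCoeff K 7 = v₃ := by
  obtain ⟨⟨h1, h609⟩, hd, hc, h3, h5, h7⟩ := h
  refine ⟨c.d, h1, h609, hd, fun K _ _ α hα hK ↦ ?_⟩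
  obtain ⟨e⟩ := exists_quadraticAlgebra_equiv hd h1 hα hK
  refine ⟨hc.classNumber_eq_two hK e, ?_, ?_, ?_⟩
  · rw [aCoeff_prime e Nat.prime_three, Nat.card_eq_fintype_card, ← h3, rootCount]
  · rw [aCoeff_prime e Nat.prime_five, Nat.card_eq_fintype_card, ← h5, rootCount]
  · rw [aCoeff_prime e Nat.prime_seven, Nat.card_eq_fintype_card, ← h7, rootCount]

end NumberField

/-- For every triple `(v₁, v₂, v₃) ∈ {0,1,2}³` there exists a squarefree integer `d` with
`1 < d ≤ 609` such that `K_d = ℚ(√d)` has class number `2` and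
`(a_3, a_5, a_7) = (v₁, v₂, v₃)`. -/
theorem stmt_17 (v₁ v₂ v₃ : ℕ) (h₁ : v₁ ≤ 2) (h₂ : v₂ ≤ 2) (h₃ : v₃ ≤ 2) :
    ∃ d : ℕ, 1 < d ∧ d ≤ 609 ∧ Squarefree d ∧
      ∀ (K : Type) [Field K] [NumberField K] (α : K),
        α ^ 2 = (d : K) → Module.finrank ℚ K = 2 →
          classNumber K = 2 ∧ aCoeff K 3 = v₁ ∧ aCoeff K 5 = v₂ ∧ aCoeff K 7 = v₃ := by
  interval_cases v₁ <;> interval_cases v₂ <;> interval_cases v₃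
  · exact ClassNumberTwoCert.exists_field
      ⟨377, 9, 2, 13, 9, 1, [3, 5, 7], []⟩
      (by decide +kernel)
  · exact ClassNumberTwoCert.exists_field
      ⟨182, 13, 19, 13, -33, 2, [3, 5, 11], [(2, -12, 1, [19]), (7, -7, 1, [19]), (13, 0, 1, [2, 7])]⟩
      (by decide +kernel)
  · exact ClassNumberTwoCert.exists_field
      ⟨533, 11, 7, 13, 13, 1, [2, 3, 5], [(11, 7, 1, [7])]⟩
      (by decide +kernel)
  · exact ClassNumberTwoCert.exists_field
      ⟨185, 6, 2, 5, 6, 1, [3], [(5, 2, 1, [2, 2, 2])]⟩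
      (by decide +kernel)
  · exact ClassNumberTwoCert.exists_field
      ⟨35, 5, 13, 5, -22, 3, [3], [(2, -3, 1, [13]), (5, -5, 1, [2])]⟩
      (by decide +kernel)
  · exact ClassNumberTwoCert.exists_field
      ⟨65, 4, 2, 5, 3, 1, [3], []⟩
      (by decide +kernel)
  · exact ClassNumberTwoCert.exists_field
      ⟨26, 5, 5, 8, -1, 1, [3], [(2, -4, 1, [5])]⟩
      (by decide +kernel)
  · exact ClassNumberTwoCert.exists_field
      ⟨119, 10, 5, 17, -12, 1, [3], [(2, -11, 1, []), (7, -7, 1, [2, 5])]⟩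
      (by decide +kernel)
  · exact ClassNumberTwoCert.exists_field
      ⟨221, 7, 5, 13, 5, 1, [2, 3], [(7, 4, 1, [5])]⟩
      (by decide +kernel)
  · exact ClassNumberTwoCert.exists_field
      ⟨87, 9, 17, 12, -41, 4, [5, 7], [(2, -11, 1, [17]), (3, -6, 1, [17])]⟩
      (by decide +kernel)
  · exact ClassNumberTwoCert.exists_field
      ⟨42, 6, 11, 8, -17, 2, [5], [(2, -8, 1, [11]), (3, -3, 1, [11])]⟩
      (by decide +kernel)
  · exact ClassNumberTwoCert.exists_field
      ⟨78, 8, 7, 13, -19, 2, [5], [(2, -4, 3, [7, 7, 7]), (3, -6, 1, [2, 7])]⟩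
      (by decide +kernel)
  · exact ClassNumberTwoCert.exists_field
      ⟨285, 8, 13, 5, 15, 1, [2, 7], [(3, 10, 1, [13]), (5, 2, 1, [13])]⟩
      (by decide +kernel)
  · exact ClassNumberTwoCert.exists_field
      ⟨105, 5, 2, 5, 5, 1, [], [(3, 1, 1, [2, 2, 2]), (5, 2, 1, [2, 2])]⟩
      (by decide +kernel)
  · exact ClassNumberTwoCert.exists_field
      ⟨15, 3, 7, 5, -8, 1, [], [(2, -1, 1, [7]), (3, -3, 1, [2])]⟩
      (by decide +kernel)
  · exact ClassNumberTwoCert.exists_field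
      ⟨66, 8, 5, 8, -17, 2, [7], [(2, -4, 1, [5, 5]), (3, -6, 1, [2, 5])]⟩
      (by decide +kernel)
  · exact ClassNumberTwoCert.exists_field
      ⟨609, 12, 2, 21, 12, 1, [], [(3, 7, 1, [2, 2, 2, 2, 2]),
        (5, 8, 1, [2, 2, 2, 2]), (7, 3, 1, [2, 2, 5]), (11, 4, 1, [2, 2, 3])]⟩
      (by decide +kernel)
  · exact ClassNumberTwoCert.exists_field
      ⟨39, 6, 5, 12, -8, 1, [], [(2, -7, 1, [5]), (3, -3, 1, [2, 5])]⟩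
      (by decide +kernel)
  · exact ClassNumberTwoCert.exists_field
      ⟨493, 11, 3, 17, 11, 1, [2, 5, 7], [(11, 9, 1, [3])]⟩
      (by decide +kernel)
  · exact ClassNumberTwoCert.exists_field
      ⟨238, 15, 3, 17, -31, 2, [5, 11], [(2, -16, 1, [3, 3]),
        (7, -7, 1, [3, 3, 3]), (13, -2, 1, [2, 3, 3])]⟩
      (by decide +kernel)
  · exact ClassNumberTwoCert.exists_field
      ⟨58, 7, 3, 8, -7, 1, [5], [(2, -2, 1, [3, 3, 3]), (7, -4, 1, [2, 3])]⟩
      (by decide +kernel)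
  · exact ClassNumberTwoCert.exists_field
      ⟨10, 3, 3, 5, -1, 1, [], [(2, -2, 1, [3])]⟩
      (by decide +kernel)
  · exact ClassNumberTwoCert.exists_field
      ⟨70, 8, 3, 5, -17, 2, [], [(2, -4, 1, [3, 3, 3]), (5, -5, 1, [3, 3]), (7, 0, 1, [2, 5])]⟩
      (by decide +kernel)
  · exact ClassNumberTwoCert.exists_field
      ⟨85, 4, 3, 5, 3, 1, [2], []⟩
      (by decide +kernel)
  · exact ClassNumberTwoCert.exists_field
      ⟨34, 5, 3, 8, -5, 1, [], [(2, -4, 1, [3, 3]), (5, -2, 1, [2, 3])]⟩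
      (by decide +kernel)
  · exact ClassNumberTwoCert.exists_field
      ⟨91, 9, 5, 13, -86, 9, [], [(2, -9, 1, [5]), (3, -4, 1, [5, 5]), (7, -7, 1, [2, 3])]⟩
      (by decide +kernel)
  · exact ClassNumberTwoCert.exists_field
      ⟨106, 10, 3, 8, -103, 10, [], [(2, -10, 1, [3]), (5, -4, 1, [2, 3, 3]), (7, -1, 1, [3, 5])]⟩
      (by decide +kernel)
end

section
/- Let d > 1 be a squarefree integer such that the prime 5 is ramified in the real quadratic field K_d = ℚ(√d) and the class number h_d of K_d is odd. Then d = 5. -/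
open NumberField

/-- The discriminant of the real quadratic field `ℚ(√d)` for a squarefree integer `d > 1`. -/
def quadDisc (d : ℕ) : ℕ := if d % 4 = 1 then d else 4 * d

open scoped NumberTheorySymbols in
/-- A number `m > 1` squarefree and prime to `5` is a non-residue modulo some prime `q ≡ 2 mod 5`
that is `1` modulo `4`. -/
theorem exists_prime_modEq_two_jacobiSym_eq_neg_one {m : ℕ} (hm1 : m ≠ 1) (hm : Squarefree m)
    (h5 : Nat.Coprime 5 m) :
    ∃ q : ℕ, q.Prime ∧ q % 4 = 1 ∧ q % 5 = 2 ∧ J(m | q) = -1 := by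
  -- simultaneous congruences modulo `5`, `a` and `b`
  have key : ∀ a b r : ℕ, a ≠ 0 → b ≠ 0 → Nat.Coprime 5 a → Nat.Coprime 5 b → Nat.Coprime a b →
      Nat.Coprime r a →
      ∃ q : ℕ, q.Prime ∧ q ≡ 2 [MOD 5] ∧ q ≡ r [MOD a] ∧ q ≡ 1 [MOD b] := by
    intro a b r ha hb h5a h5b hab hra
    obtain ⟨s, hs1, hs2⟩ := Nat.chineseRemainder hab r 1
    obtain ⟨t, ht1, ht2⟩ := Nat.chineseRemainder (h5a.mul_right h5b) 2 s
    have hta : t ≡ r [MOD a] := (ht2.of_mul_right b).trans hs1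
    have htb : t ≡ 1 [MOD b] := (ht2.of_mul_left a).trans hs2
    have hcop : t.Coprime (5 * (a * b)) := by
      refine Nat.Coprime.mul_right ?_ (Nat.Coprime.mul_right ?_ ?_)
      · rw [Nat.Coprime, ht1.gcd_eq]; rfl
      · rw [Nat.Coprime, hta.gcd_eq]; exact hra
      · rw [Nat.Coprime, htb.gcd_eq]; simp
    obtain ⟨q, -, hq, hqt⟩ := Nat.forall_exists_prime_gt_and_modEq 0
      (by positivity : 5 * (a * b) ≠ 0) hcop
    exact ⟨q, hq, (hqt.of_mul_right _).trans ht1,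
      ((hqt.of_mul_left 5).of_mul_right b).trans hta,
      ((hqt.of_mul_left 5).of_mul_left a).trans htb⟩
  have recip : ∀ q k : ℕ, q % 4 = 1 → Odd k → q ≡ 1 [MOD k] → J(k | q) = 1 := by
    intro q k hq hk hqk
    rw [← jacobiSym.quadratic_reciprocity_one_mod_four hq hk,
      jacobiSym.mod_left' (a₂ := 1) (by exact_mod_cast hqk), jacobiSym.one_left]
  rcases Nat.even_or_odd m with hev | hodd
  · obtain ⟨k, rfl⟩ := hev.two_dvd
    have h2k : Nat.Coprime 2 k := Nat.coprime_of_squarefree_mul hm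
    have hkodd : Odd k := by simpa using h2k
    obtain ⟨q, hq, hq5, hq8, hqk⟩ := key 8 k 5 (by norm_num) hkodd.pos.ne' (by norm_num)
      h5.coprime_mul_left_right (Nat.Coprime.pow_left 3 h2k) (by norm_num)
    have h8 : q % 8 = 5 := hq8
    have h4 : q % 4 = 1 := by omega
    refine ⟨q, hq, h4, hq5, ?_⟩
    rw [Nat.cast_mul, jacobiSym.mul_left, recip q k h4 hkodd hqk, Nat.cast_two,
      jacobiSym.at_two (Nat.odd_iff.mpr (by omega)), ZMod.χ₈_nat_mod_eight, h8]
    decide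
  · obtain ⟨p, hp, k, rfl⟩ := Nat.exists_prime_and_dvd hm1
    have hpk : p.Coprime k := Nat.coprime_of_squarefree_mul hm
    obtain ⟨hpodd, hkodd⟩ := Nat.odd_mul.mp hodd
    have : Fact p.Prime := ⟨hp⟩
    have hp2 : p ≠ 2 := by rintro rfl; exact absurd hpodd (by decide)
    obtain ⟨r, hr⟩ := FiniteField.exists_nonsquare (F := ZMod p) (by rwa [ZMod.ringChar_zmod_n])
    have hJr : J(r.val | p) = -1 := by
      rw [← jacobiSym.legendreSym.to_jacobiSym, legendreSym.eq_neg_one_iff]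
      simpa using hr
    have hrp : r.val.Coprime p := by
      refine (ZMod.val_coe_unit_coprime (Units.mk0 r ?_))
      rintro rfl; exact hr (IsSquare.zero)
    have hp4 : p.Coprime 4 := (Nat.coprime_two_right.mpr hpodd).pow_right 2
    obtain ⟨q, hq, hq5, hqp, hqk⟩ := key p (4 * k) r.val hp.ne_zero (by have := hkodd.pos; omega)
      h5.coprime_mul_right_right (Nat.Coprime.mul_right (by norm_num) h5.coprime_mul_left_right)
      (hp4.mul_right hpk) hrp
    have h4 : q % 4 = 1 := hqk.of_mul_right k
    refine ⟨q, hq, h4, hq5, ?_⟩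
    rw [Nat.cast_mul, jacobiSym.mul_left, recip q k h4 hkodd (hqk.of_mul_left 4), mul_one,
      ← jacobiSym.quadratic_reciprocity_one_mod_four h4 hpodd,
      jacobiSym.mod_left' (a₂ := r.val) (by exact_mod_cast hqp), hJr]

open scoped NumberTheorySymbols in
/-- If `5 ∣ d` and `d ≠ 5` is squarefree, there is an odd prime `q ≡ 2 mod 5` not dividing `d`
modulo which `d` is a square. -/
theorem exists_prime_modEq_two_dvd_sq_sub {d : ℕ} (hd : Squarefree d) (h5 : 5 ∣ d) (hd5 : d ≠ 5) :
    ∃ q : ℕ, q.Prime ∧ q % 5 = 2 ∧ ∃ b : ℤ, (q : ℤ) ∣ b ^ 2 - d ∧ ¬ (q : ℤ) ∣ 2 * b := by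
  obtain ⟨m, rfl⟩ := h5
  obtain ⟨q, hq, h4, hq5, hJ⟩ := exists_prime_modEq_two_jacobiSym_eq_neg_one
    (m := m) (by rintro rfl; simp at hd5) (hd.of_mul_right)
    (Nat.coprime_of_squarefree_mul hd)
  have : Fact q.Prime := ⟨hq⟩
  have hJ5 : J(5 | q) = -1 := by
    have h := jacobiSym.quadratic_reciprocity_one_mod_four (a := q) (b := 5) h4 (by decide)
    rw [jacobiSym.mod_left, show ((q : ℤ) % (5 : ℕ)) = 2 by omega] at h
    rw [← Nat.cast_ofNat, ← h]
    rw [jacobiSym.at_two (by decide)]; decide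
  have hJd : J((5 * m : ℕ) | q) = 1 := by
    rw [Nat.cast_mul, jacobiSym.mul_left, hJ, Nat.cast_ofNat, hJ5]; norm_num
  obtain ⟨c, hc⟩ := ZMod.isSquare_of_jacobiSym_eq_one hJd
  have hqd : ¬ (q : ℤ) ∣ (5 * m : ℕ) := by
    intro h
    rw [jacobiSym.mod_left, Int.emod_eq_zero_of_dvd h, jacobiSym.zero_left hq.one_lt] at hJd
    exact zero_ne_one hJd
  have hb : (q : ℤ) ∣ (c.val : ℤ) ^ 2 - (5 * m : ℕ) := by
    rw [← ZMod.intCast_zmod_eq_zero_iff_dvd]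
    push_cast at hc ⊢
    rw [hc]; simp [sq]
  refine ⟨q, hq, hq5, c.val, hb, fun h => ?_⟩
  rcases (Nat.prime_iff_prime_int.mp hq).dvd_or_dvd h with h | h
  · have := Int.le_of_dvd (by norm_num) h
    have := hq.two_le
    have : q = 2 := by omega
    omega
  · exact hqd ((dvd_sub_right (dvd_pow h two_ne_zero)).mp hb)

/-- The trace and norm of a quadratic extension in terms of a square root generating it. -/
theorem trace_norm_of_finrank_eq_two {F K : Type*} [Field F] [Field K] [Algebra F K]
    (hdeg : Module.finrank F K = 2) {α : K} {d : F} (hα : α ^ 2 = algebraMap F K d)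
    (hd : ¬ IsSquare d) :
    (∀ a : K, ∃ x y : F, a = algebraMap F K x + algebraMap F K y * α) ∧
    ∀ x y : F, Algebra.trace F K (algebraMap F K x + algebraMap F K y * α) = 2 * x ∧
      Algebra.norm F (algebraMap F K x + algebraMap F K y * α) = x ^ 2 - d * y ^ 2 := by
  have hli : LinearIndependent F ![1, α] := by
    rw [LinearIndependent.pair_iff]
    intro s t h
    have ht : t = 0 := by
      by_contra ht
      refine hd ⟨-(s / t), (algebraMap F K).injective ?_⟩
      have h0 : algebraMap F K t ≠ 0 := by simpa using ht
      have h1 : α = algebraMap F K (-(s / t)) := by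
        simp only [Algebra.smul_def] at h
        simp only [map_neg, map_div₀]
        field_simp
        linear_combination h
      rw [← hα, map_mul, ← h1, sq]
    subst ht
    simpa using h
  have : FiniteDimensional F K := FiniteDimensional.of_finrank_eq_succ hdeg
  let b := basisOfLinearIndependentOfCardEqFinrank hli (by simp [hdeg])
  have hb0 : b 0 = 1 := by simp [b]
  have hb1 : b 1 = α := by simp [b]
  refine ⟨fun a => ⟨b.repr a 0, b.repr a 1, ?_⟩, fun x y => ?_⟩
  · conv_lhs => rw [← b.sum_repr a]
    simp [hb0, hb1, Algebra.smul_def]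
  obtain ⟨a, ha⟩ : ∃ a, a = algebraMap F K x + algebraMap F K y * α := ⟨_, rfl⟩
  rw [← ha]
  have h0 : a * b 0 = x • b 0 + y • b 1 := by
    simp [hb0, hb1, Algebra.smul_def, ha]
  have h1 : a * b 1 = (d * y) • b 0 + x • b 1 := by
    simp only [hb0, hb1, Algebra.smul_def, ha, map_mul, ← hα]; ring
  have hM : Algebra.leftMulMatrix b a = !![x, d * y; y, x] := by
    ext i j
    rw [Algebra.leftMulMatrix_eq_repr_mul]
    fin_cases i <;> fin_cases j <;> simp [h0, h1, -mul_eq_mul_left_iff]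
  refine ⟨?_, ?_⟩
  · rw [Algebra.trace_eq_matrix_trace b, hM, Matrix.trace_fin_two_of]; ring
  · rw [Algebra.norm_eq_matrix_det b, hM, Matrix.det_fin_two_of]; ring

/-- If `b + √d` is divisible by the integer `q`, then `q` divides its trace `2 * b`. -/
theorem int_dvd_two_mul_of_dvd_add {K : Type*} [Field K] [NumberField K]
    (hdeg : Module.finrank ℚ K = 2) {α : 𝓞 K} {d : ℕ} (hα : α ^ 2 = (d : 𝓞 K))
    (hd : ¬ IsSquare (d : ℚ)) {q b : ℤ} (h : (q : 𝓞 K) ∣ b + α) : q ∣ 2 * b := by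
  obtain ⟨w, hw⟩ := h
  have hαK : (α : K) ^ 2 = algebraMap ℚ K d := by
    rw [map_natCast]; exact_mod_cast congrArg (algebraMap (𝓞 K) K) hα
  have htr := ((trace_norm_of_finrank_eq_two hdeg hαK hd).2 b 1).1
  have hwK : algebraMap ℚ K b + algebraMap ℚ K 1 * α = (q : ℚ) • (w : K) := by
    have := congrArg (algebraMap (𝓞 K) K) hw
    simpa [Algebra.smul_def] using this
  rw [hwK, map_smul, ← Algebra.coe_trace_int] at htr
  refine ⟨Algebra.trace ℤ (𝓞 K) w, ?_⟩
  rw [smul_eq_mul] at htr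
  exact_mod_cast htr.symm

/-- Modulo a divisor of `d`, four times the norm of an integer of `ℚ(√d)` is a square. -/
theorem exists_sq_modEq_four_mul_norm {K : Type*} [Field K] [NumberField K]
    (hdeg : Module.finrank ℚ K = 2) {α : K} {d p : ℕ} (hα : α ^ 2 = (d : K))
    (hd : Squarefree d) (hd' : ¬ IsSquare (d : ℚ)) (hpd : p ∣ d) (a : 𝓞 K) :
    ∃ t : ℤ, 4 * Algebra.norm ℤ a ≡ t ^ 2 [ZMOD p] := by
  have hαK : α ^ 2 = algebraMap ℚ K d := by rw [map_natCast, hα]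
  obtain ⟨hex, htn⟩ := trace_norm_of_finrank_eq_two hdeg hαK hd'
  obtain ⟨x, y, hxy⟩ := hex a
  obtain ⟨ht, hn⟩ := htn x y
  rw [← hxy, ← Algebra.coe_trace_int] at ht
  rw [← hxy, ← Algebra.coe_norm_int] at hn
  set t := Algebra.trace ℤ (𝓞 K) a
  set n := Algebra.norm ℤ a
  have hs : ((t ^ 2 - 4 * n : ℤ) : ℚ) = d * (2 * y) ^ 2 := by
    push_cast; rw [ht, hn]; ring
  have hsq : ((d * (t ^ 2 - 4 * n) : ℤ) : ℚ) = (2 * y * d) ^ 2 := by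
    rw [Int.cast_mul, hs]; push_cast; ring
  obtain ⟨k, hk⟩ : IsSquare (d * (t ^ 2 - 4 * n) : ℤ) := by
    rw [← Rat.isSquare_intCast_iff, hsq]; exact IsSquare.sq _
  have hd0 : (d : ℤ) ≠ 0 := by exact_mod_cast hd.ne_zero
  have hdk : (d : ℤ) ∣ k := by
    refine ((Int.squarefree_natCast.mpr hd).dvd_pow_iff_dvd two_ne_zero).mp ?_
    exact ⟨_, (sq k).trans hk.symm⟩
  obtain ⟨l, rfl⟩ := hdk
  refine ⟨t, (Int.modEq_iff_dvd).mpr ?_⟩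
  have : t ^ 2 - 4 * n = d * (l * l) := mul_left_cancel₀ hd0 (by linear_combination hk)
  rw [this]
  exact (Int.natCast_dvd_natCast.mpr hpd).mul_right _

/-- If `d` is a nonzero square `b ^ 2` modulo an odd prime `q`, then `(q, b + √d)` has norm `q`. -/
theorem absNorm_span_pair_eq_prime {K : Type*} [Field K] [NumberField K]
    (hdeg : Module.finrank ℚ K = 2) {α : 𝓞 K} {d : ℕ} (hα : α ^ 2 = (d : 𝓞 K))
    (hd : ¬ IsSquare (d : ℚ)) {q : ℕ} (hq : q.Prime) {b : ℤ} (hqb : (q : ℤ) ∣ b ^ 2 - d)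
    (hb : ¬ (q : ℤ) ∣ 2 * b) :
    Ideal.absNorm (Ideal.span {(q : 𝓞 K), b + α}) = q := by
  obtain ⟨c, hc⟩ := hqb
  have hc' : (b : 𝓞 K) ^ 2 - d = q * c := by exact_mod_cast congrArg (Int.cast : ℤ → 𝓞 K) hc
  have key : ∀ β : 𝓞 K, β ^ 2 = (d : 𝓞 K) →
      Ideal.absNorm (Ideal.span {(q : 𝓞 K), b + β}) ≠ 1 := by
    intro β hβ h
    rw [Ideal.absNorm_eq_one_iff, Ideal.eq_top_iff_one, Ideal.mem_span_pair] at h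
    obtain ⟨u, v, huv⟩ := h
    refine hb (int_dvd_two_mul_of_dvd_add hdeg (α := -β) (by rw [neg_sq, hβ]) hd
      ⟨u * (b - β) + v * c, ?_⟩)
    push_cast
    linear_combination (-(b - β)) * huv + v * hc' - v * hβ
  have hmul : Ideal.span {(q : 𝓞 K), b + α} * Ideal.span {(q : 𝓞 K), b + -α} =
      Ideal.span {(q : 𝓞 K)} := by
    rw [Ideal.span_pair_mul_span_pair]
    apply le_antisymm
    · rw [Ideal.span_le]
      rintro x (rfl | rfl | rfl | rfl) <;> rw [SetLike.mem_coe, Ideal.mem_span_singleton]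
      · exact dvd_mul_right _ _
      · exact dvd_mul_right _ _
      · exact dvd_mul_left _ _
      · exact ⟨c, by linear_combination hc' - hα⟩
    · rw [Ideal.span_singleton_le_iff_mem]
      obtain ⟨u, v, huv⟩ := ((Nat.prime_iff_prime_int.mp hq).coprime_iff_not_dvd).mpr hb
      have huv' : (u : 𝓞 K) * q + v * (2 * b) = 1 := by
        exact_mod_cast congrArg (Int.cast : ℤ → 𝓞 K) huv
      have h : (u : 𝓞 K) * (q * q) + v * (q * (b + -α)) + v * ((b + α) * q) ∈
          Ideal.span {(q : 𝓞 K) * q, q * (b + -α), (b + α) * q, (b + α) * (b + -α)} := by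
        refine add_mem (add_mem ?_ ?_) ?_ <;>
          exact Ideal.mul_mem_left _ _ (Ideal.subset_span (by simp))
      convert h using 1
      linear_combination (-(q : 𝓞 K)) * huv'
  have hnorm := congrArg Ideal.absNorm hmul
  rw [map_mul, Ideal.absNorm_span_singleton, ← map_natCast (algebraMap ℤ (𝓞 K)),
    Algebra.norm_algebraMap, RingOfIntegers.rank, hdeg, Int.natAbs_pow] at hnorm
  have h : Ideal.absNorm (Ideal.span {(q : 𝓞 K), b + α}) *
      Ideal.absNorm (Ideal.span {(q : 𝓞 K), b + -α}) = q ^ 2 := by simpa using hnorm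
  exact ((hq.mul_eq_prime_sq_iff (key α hα) (key (-α) (by rw [neg_sq, hα]))).mp h).1

/-- If `h` is the class number and `I` is an ideal of norm `n`, then `± n ^ h` is a norm. -/
theorem exists_natAbs_norm_eq_absNorm_pow_classNumber {K : Type*} [Field K] [NumberField K]
    {I : Ideal (𝓞 K)} (hI : I ≠ ⊥) :
    ∃ a : 𝓞 K, (Algebra.norm ℤ a).natAbs = Ideal.absNorm I ^ classNumber K := by
  obtain ⟨J, rfl⟩ : ∃ J : nonZeroDivisors (Ideal (𝓞 K)), (J : Ideal (𝓞 K)) = I :=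
    ⟨⟨I, mem_nonZeroDivisors_of_ne_zero hI⟩, rfl⟩
  have h1 : ClassGroup.mk0 (J ^ classNumber K) = 1 := by
    rw [map_pow, classNumber, pow_card_eq_one]
  obtain ⟨a, ha⟩ := ((ClassGroup.mk0_eq_one_iff (J ^ classNumber K).2).mp h1).principal
  refine ⟨a, ?_⟩
  rw [← Ideal.absNorm_span_singleton, ← map_pow, ← SubmonoidClass.coe_pow, ha,
    Ideal.submodule_span_eq]

/-- If the prime `5` is ramified in `K_d = ℚ(√d)` (equivalently, `5` divides the
discriminant `D`) and the class number `h_d` is odd, then `d = 5`. -/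
theorem stmt_18 (d : ℕ) (hd1 : 1 < d) (hdsf : Squarefree d)
    (K : Type*) [Field K] [NumberField K] (α : K)
    (hα : α ^ 2 = (d : K)) (hdeg : Module.finrank ℚ K = 2)
    (hram : 5 ∣ quadDisc d) (hodd : Odd (classNumber K)) :
    d = 5 := by
  have h5d : 5 ∣ d := by
    unfold quadDisc at hram
    split_ifs at hram <;> omega
  by_contra hd5
  obtain ⟨q, hq, hq5, b, hqb, hb⟩ := exists_prime_modEq_two_dvd_sq_sub hdsf h5d hd5
  have hsq : ¬ IsSquare (d : ℚ) := by
    rw [Rat.isSquare_natCast_iff]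
    rintro ⟨k, rfl⟩
    have := Nat.isUnit_iff.mp (hdsf k dvd_rfl)
    simp [this] at hd1
  let A : 𝓞 K := ⟨α, IsIntegral.of_pow two_pos (hα ▸ isIntegral_natCast d)⟩
  have hA : A ^ 2 = (d : 𝓞 K) := by
    apply RingOfIntegers.coe_injective
    rw [map_pow, map_natCast]
    exact hα
  have hN := absNorm_span_pair_eq_prime hdeg hA hsq hq hqb hb
  obtain ⟨a, ha⟩ := exists_natAbs_norm_eq_absNorm_pow_classNumber
    (I := Ideal.span {(q : 𝓞 K), b + A}) (by
      intro h
      rw [h, Ideal.absNorm_bot] at hN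
      exact hq.ne_zero hN.symm)
  rw [hN] at ha
  obtain ⟨t, ht⟩ := exists_sq_modEq_four_mul_norm hdeg hα hdsf hsq h5d a
  obtain ⟨k, hk⟩ := hodd
  have hmod : q ^ classNumber K % 5 = 2 ∨ q ^ classNumber K % 5 = 3 := by
    rw [hk, pow_succ, pow_mul, Nat.mul_mod, Nat.pow_mod, Nat.pow_mod q, hq5]
    rcases Nat.even_or_odd' k with ⟨j, rfl | rfl⟩ <;>
      simp [pow_succ, pow_mul, Nat.mul_mod, Nat.pow_mod]
  have htmod : t ^ 2 % 5 = 0 ∨ t ^ 2 % 5 = 1 ∨ t ^ 2 % 5 = 4 := by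
    have h : t % 5 = 0 ∨ t % 5 = 1 ∨ t % 5 = 2 ∨ t % 5 = 3 ∨ t % 5 = 4 := by omega
    rcases h with h | h | h | h | h <;> simp [pow_two, Int.mul_emod, h]
  have ht' : 4 * Algebra.norm ℤ a % 5 = t ^ 2 % 5 := ht
  omega
end
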